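/- Suppose the limit L = lim_{n→∞} (M_n)^{1/n} exists and satisfies 3.37343 < L ≤ √12.901. Then lim_{n→∞} M^{Irr}_n / M_n = 0. -/

import Mathlib

open Filter

/-- `x` lies strictly between `p` and `q`. -/
def StrictlyBetween (p q x : ℕ) : Prop := min p q < x ∧ x < max p q

/-- Two arcs `{p, q}` and `{r, s}` cross if exactly one of `r`, `s` lies strictly
between `p` and `q`. -/
def ArcsCross (p q r s : ℕ) : Prop :=
  Xor' (StrictlyBetween p q r) (StrictlyBetween p q s)

/-- `a` (with one-based indexing, only the values `a 1, …, a n` being relevant)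
is an open meandric permutation of order `n`: it is a permutation of `{1, …, n}`
with `a i ≡ i (mod 2)`, whose upper arcs (pairs `{a i, a (i+1)}` for odd `i < n`)
are pairwise noncrossing, whose lower arcs (pairs `{a i, a (i+1)}` for even
`1 ≤ i < n`) are pairwise noncrossing, such that no lower arc strictly encloses
`a 1`, and no lower arc (if `n` is even) resp. upper arc (if `n` is odd)
strictly encloses `a n`. -/
def IsOpenMeandricPerm (n : ℕ) (a : ℕ → ℕ) : Prop :=
  1 ≤ n ∧
  (∀ i, 1 ≤ i → i ≤ n → 1 ≤ a i ∧ a i ≤ n) ∧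
  (∀ i j, 1 ≤ i → i ≤ n → 1 ≤ j → j ≤ n → a i = a j → i = j) ∧
  (∀ i, 1 ≤ i → i ≤ n → a i % 2 = i % 2) ∧
  (∀ i j, Odd i → i < n → Odd j → j < n →
      ¬ ArcsCross (a i) (a (i + 1)) (a j) (a (j + 1))) ∧
  (∀ i j, Even i → 1 ≤ i → i < n → Even j → 1 ≤ j → j < n →
      ¬ ArcsCross (a i) (a (i + 1)) (a j) (a (j + 1))) ∧
  (∀ i, Even i → 1 ≤ i → i < n → ¬ StrictlyBetween (a i) (a (i + 1)) (a 1)) ∧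
  (if Even n
    then ∀ i, Even i → 1 ≤ i → i < n → ¬ StrictlyBetween (a i) (a (i + 1)) (a n)
    else ∀ i, Odd i → i < n → ¬ StrictlyBetween (a i) (a (i + 1)) (a n))

/-- An open meandric permutation of order `n` is irreducible if there are no
indices `1 ≤ k₁ < k₂ ≤ n` with `2 < k₂ - k₁ ≤ n - 2` such that the values
`a k₁, …, a k₂` form an interval of integers, i.e. their max minus their min
equals `k₂ - k₁`. -/
def IsIrreducibleMeander (n : ℕ) (a : ℕ → ℕ) : Prop :=
  ¬ ∃ k₁ k₂ : ℕ, ∃ h : k₁ < k₂, 1 ≤ k₁ ∧ k₂ ≤ n ∧ 2 < k₂ - k₁ ∧ k₂ - k₁ ≤ n - 2 ∧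
    (Finset.Icc k₁ k₂).sup' (Finset.nonempty_Icc.mpr h.le) a -
      (Finset.Icc k₁ k₂).inf' (Finset.nonempty_Icc.mpr h.le) a = k₂ - k₁

/-- An open meandric permutation of order `n` is prime if `a 1 ≠ 1` and no proper
initial segment `a 1, …, a j` (`2 ≤ j < n`) is a permutation of `{1, …, j}`. -/
def IsPrimeMeander (n : ℕ) (a : ℕ → ℕ) : Prop :=
  a 1 ≠ 1 ∧ ¬ ∃ j, 2 ≤ j ∧ j < n ∧ (Finset.Icc 1 j).image a = Finset.Icc 1 j

/-- `a` (with one-based indexing) is a closed meandric permutation of order `n`: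
a permutation of `{1, …, 2n}` with `a 1 = 1`, `a i ≡ i (mod 2)`, pairwise
noncrossing upper arcs `{a i, a (i+1)}` (odd `i < 2n`) and pairwise noncrossing
lower arcs, the latter being the `{a i, a (i+1)}` for even `1 ≤ i < 2n` together
with the wrap-around arc `{a (2n), a 1}`. -/
def IsClosedMeandricPerm (n : ℕ) (a : ℕ → ℕ) : Prop :=
  1 ≤ n ∧ a 1 = 1 ∧
  (∀ i, 1 ≤ i → i ≤ 2 * n → 1 ≤ a i ∧ a i ≤ 2 * n) ∧
  (∀ i j, 1 ≤ i → i ≤ 2 * n → 1 ≤ j → j ≤ 2 * n → a i = a j → i = j) ∧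
  (∀ i, 1 ≤ i → i ≤ 2 * n → a i % 2 = i % 2) ∧
  (∀ i j, Odd i → i < 2 * n → Odd j → j < 2 * n →
      ¬ ArcsCross (a i) (a (i + 1)) (a j) (a (j + 1))) ∧
  (∀ i j, Even i → 1 ≤ i → i < 2 * n → Even j → 1 ≤ j → j < 2 * n →
      ¬ ArcsCross (a i) (a (i + 1)) (a j) (a (j + 1))) ∧
  (∀ i, Even i → 1 ≤ i → i < 2 * n →
      ¬ ArcsCross (a i) (a (i + 1)) (a (2 * n)) (a 1) ∧
      ¬ ArcsCross (a (2 * n)) (a 1) (a i) (a (i + 1)))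

/-- `M n`: the number of open meandric permutations of order `n` (each counted
once via the normalization `a i = 0` outside `{1, …, n}`). -/
noncomputable def openMeanderCount (n : ℕ) : ℕ :=
  Set.ncard {a : ℕ → ℕ | IsOpenMeandricPerm n a ∧ ∀ i, i < 1 ∨ n < i → a i = 0}

/-- `M^{Irr} n`: the number of irreducible open meandric permutations of order `n`. -/
noncomputable def irrMeanderCount (n : ℕ) : ℕ :=
  Set.ncard {a : ℕ → ℕ | IsOpenMeandricPerm n a ∧ IsIrreducibleMeander n a ∧
    ∀ i, i < 1 ∨ n < i → a i = 0}

/-- `M^{(P)} n`: the number of prime open meandric permutations of order `n`. -/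
noncomputable def primeMeanderCount (n : ℕ) : ℕ :=
  Set.ncard {a : ℕ → ℕ | IsOpenMeandricPerm n a ∧ IsPrimeMeander n a ∧
    ∀ i, i < 1 ∨ n < i → a i = 0}

/-- `M̄ n`: the number of closed meandric permutations of order `n`. -/
noncomputable def closedMeanderCount (n : ℕ) : ℕ :=
  Set.ncard {a : ℕ → ℕ | IsClosedMeandricPerm n a ∧ ∀ i, i < 1 ∨ 2 * n < i → a i = 0}

/-- Replace the point at position `k` of `a` by an increasing run of five consecutive values. -/
def insertRun (k : ℕ) (a : ℕ → ℕ) (i : ℕ) : ℕ :=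
  if i < k then (if a i ≤ a k then a i else a i + 4)
  else if i ≤ k + 4 then a k + (i - k)
  else (if a (i - 4) ≤ a k then a (i - 4) else a (i - 4) + 4)

theorem insertRun_of_lt {k i : ℕ} (a : ℕ → ℕ) (hi : i < k) :
    insertRun k a i = if a i ≤ a k then a i else a i + 4 := if_pos hi

theorem insertRun_add (k : ℕ) (a : ℕ → ℕ) {t : ℕ} (ht : t ≤ 4) :
    insertRun k a (k + t) = a k + t := by
  unfold insertRun
  rw [if_neg (by omega), if_pos (by omega), Nat.add_sub_cancel_left]

theorem insertRun_add_four_of_lt {k i : ℕ} (a : ℕ → ℕ) (hi : k < i) :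
    insertRun k a (i + 4) = if a i ≤ a k then a i else a i + 4 := by
  unfold insertRun
  rw [if_neg (by omega), if_neg (by omega), Nat.add_sub_cancel]

/-- Open a gap of length four just below `w`. -/
def openGap (w x : ℕ) : ℕ := if x < w then x else x + 4

theorem strictlyBetween_openGap {w p q x : ℕ}
    (h : StrictlyBetween (openGap w p) (openGap w q) (openGap w x)) :
    StrictlyBetween p q x := by
  unfold StrictlyBetween openGap at *
  grind

theorem strictlyBetween_openGap_iff {w p q x : ℕ} :
    StrictlyBetween (openGap w p) (openGap w q) (openGap w x) ↔ StrictlyBetween p q x := by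
  refine ⟨strictlyBetween_openGap, fun h => ?_⟩
  unfold StrictlyBetween openGap at *
  grind

theorem not_strictlyBetween_succ (p x : ℕ) : ¬ StrictlyBetween p (p + 1) x := by
  unfold StrictlyBetween
  omega

theorem strictlyBetween_gap_succ_iff {w p q s : ℕ} (hs : s ≤ 2) :
    StrictlyBetween (openGap w p) (openGap w q) (w + s) ↔
      StrictlyBetween (openGap w p) (openGap w q) (w + s + 1) := by
  unfold StrictlyBetween openGap
  grind

/-- An arc of `insertRun k a` is a shifted arc of `a` of the same side, or an arc inside the
inserted run; on the side of parity `c`, the shift opens a gap at `a k` or at `a k + 1`. -/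
theorem insertRun_arc {n k : ℕ} {a : ℕ → ℕ} (hk : 1 ≤ k) (hkn : k ≤ n)
    (hinj : ∀ i j, 1 ≤ i → i ≤ n → 1 ≤ j → j ≤ n → a i = a j → i = j)
    {c w : ℕ} (hw : w = if c % 2 = k % 2 then a k else a k + 1)
    {i : ℕ} (hi : 1 ≤ i) (hin : i < n + 4) (hc : i % 2 = c % 2) :
    (∃ i', 1 ≤ i' ∧ i' < n ∧ i' % 2 = c % 2 ∧ insertRun k a i = openGap w (a i') ∧
      insertRun k a (i + 1) = openGap w (a (i' + 1))) ∨
    (∃ s, s ≤ 2 ∧ insertRun k a i = w + s ∧ insertRun k a (i + 1) = w + s + 1) := by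
  rcases lt_or_ge i k with h1 | h1
  · left
    refine ⟨i, hi, by omega, hc, ?_, ?_⟩
    · have := hinj i k hi (by omega) hk hkn
      unfold insertRun openGap
      grind
    · have := hinj (i + 1) k (by omega) (by omega) hk hkn
      unfold insertRun openGap
      rcases eq_or_ne (i + 1) k with h2 | h2
      · subst h2
        grind
      · grind
  · rcases lt_or_ge i (k + 4) with h2 | h2
    · right
      obtain ⟨t, rfl⟩ := Nat.exists_eq_add_of_le h1
      have e1 : insertRun k a (k + t) = a k + t := insertRun_add k a (by omega)
      have e2 : insertRun k a (k + t + 1) = a k + t + 1 :=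
        insertRun_add k a (t := t + 1) (by omega)
      rw [e1, e2]
      split_ifs at hw
      · exact ⟨t, by omega, by omega, by omega⟩
      · exact ⟨t - 1, by omega, by omega, by omega⟩
    · left
      obtain ⟨t, rfl⟩ := Nat.exists_eq_add_of_le h2
      have e2 : insertRun k a (k + 4 + t + 1) =
          if a (k + t + 1) ≤ a k then a (k + t + 1) else a (k + t + 1) + 4 := by
        rw [← insertRun_add_four_of_lt a (by omega : k < k + t + 1)]
        congr 1
        omega
      have e1 : insertRun k a (k + 4 + t) = if t = 0 then a k + 4 else
          if a (k + t) ≤ a k then a (k + t) else a (k + t) + 4 := by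
        rcases Nat.eq_zero_or_pos t with rfl | ht
        · exact insertRun_add k a le_rfl
        · rw [if_neg ht.ne', ← insertRun_add_four_of_lt a (by omega : k < k + t)]
          congr 1
          omega
      have n1 := hinj (k + t) k (by omega) (by omega) hk hkn
      have n2 := hinj (k + t + 1) k (by omega) (by omega) hk hkn
      refine ⟨k + t, by omega, by omega, by omega, ?_, ?_⟩
      · rw [e1]
        unfold openGap
        rcases Nat.eq_zero_or_pos t with rfl | ht
        · grind
        · grind
      · rw [e2]
        unfold openGap
        grind

theorem insertRun_not_arcsCross {n k : ℕ} {a : ℕ → ℕ} (hk : 1 ≤ k) (hkn : k ≤ n)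
    (hinj : ∀ i j, 1 ≤ i → i ≤ n → 1 ≤ j → j ≤ n → a i = a j → i = j) (c : ℕ)
    (hcross : ∀ i j, 1 ≤ i → i < n → i % 2 = c % 2 → 1 ≤ j → j < n → j % 2 = c % 2 →
      ¬ ArcsCross (a i) (a (i + 1)) (a j) (a (j + 1)))
    {i j : ℕ} (hi : 1 ≤ i) (hin : i < n + 4) (hic : i % 2 = c % 2)
    (hj : 1 ≤ j) (hjn : j < n + 4) (hjc : j % 2 = c % 2) :
    ¬ ArcsCross (insertRun k a i) (insertRun k a (i + 1))
      (insertRun k a j) (insertRun k a (j + 1)) := by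
  rcases insertRun_arc hk hkn hinj rfl hi hin hic with
    ⟨i', h1, h2, h3, h4, h5⟩ | ⟨s, -, h4, h5⟩ <;> rw [h4, h5]
  · rcases insertRun_arc hk hkn hinj rfl hj hjn hjc with
      ⟨j', g1, g2, g3, g4, g5⟩ | ⟨s, hs, g4, g5⟩ <;> rw [g4, g5]
    · have := hcross i' j' h1 h2 h3 g1 g2 g3
      unfold ArcsCross at *
      simpa only [strictlyBetween_openGap_iff] using this
    · unfold ArcsCross
      rw [← strictlyBetween_gap_succ_iff hs]
      exact fun h => h.elim (fun h => h.2 h.1) (fun h => h.2 h.1)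
  · unfold ArcsCross
    exact fun h => h.elim (fun h => not_strictlyBetween_succ _ _ h.1)
      (fun h => not_strictlyBetween_succ _ _ h.1)

theorem insertRun_not_strictlyBetween {n k : ℕ} {a : ℕ → ℕ} (hk : 1 ≤ k) (hkn : k ≤ n)
    (hinj : ∀ i j, 1 ≤ i → i ≤ n → 1 ≤ j → j ≤ n → a i = a j → i = j) (c x : ℕ)
    (hx : ∀ i, 1 ≤ i → i < n → i % 2 = c % 2 → ¬ StrictlyBetween (a i) (a (i + 1)) x)
    {i : ℕ} (hi : 1 ≤ i) (hin : i < n + 4) (hic : i % 2 = c % 2) :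
    ¬ StrictlyBetween (insertRun k a i) (insertRun k a (i + 1))
      (openGap (if c % 2 = k % 2 then a k else a k + 1) x) := by
  rcases insertRun_arc hk hkn hinj rfl hi hin hic with
    ⟨i', h1, h2, h3, h4, h5⟩ | ⟨s, -, h4, h5⟩ <;> rw [h4, h5]
  · rw [strictlyBetween_openGap_iff]
    exact hx i' h1 h2 h3
  · exact not_strictlyBetween_succ _ _

theorem insertRun_injOn {n k : ℕ} {a : ℕ → ℕ} (hk : 1 ≤ k) (hkn : k ≤ n)
    (hinj : ∀ i j, 1 ≤ i → i ≤ n → 1 ≤ j → j ≤ n → a i = a j → i = j)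
    {i j : ℕ} (hi : 1 ≤ i) (hin : i ≤ n + 4) (hj : 1 ≤ j) (hjn : j ≤ n + 4)
    (h : insertRun k a i = insertRun k a j) : i = j := by
  have values : ∀ i, 1 ≤ i → i ≤ n + 4 →
      (∃ x, 1 ≤ x ∧ x ≤ n ∧ a x ≠ a k ∧ i = (if x < k then x else x + 4) ∧
        insertRun k a i = if a x ≤ a k then a x else a x + 4) ∨
      ∃ t, t ≤ 4 ∧ i = k + t ∧ insertRun k a i = a k + t := by
    intro i hi hin
    rcases lt_or_ge i k with h1 | h1
    · exact Or.inl ⟨i, hi, by omega, fun h => h1.ne (hinj i k hi (by omega) hk hkn h),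
        (if_pos h1).symm, insertRun_of_lt a h1⟩
    · rcases le_or_gt i (k + 4) with h2 | h2
      · obtain ⟨t, rfl⟩ := Nat.exists_eq_add_of_le h1
        exact Or.inr ⟨t, by omega, rfl, insertRun_add k a (by omega)⟩
      · obtain ⟨x, rfl⟩ := Nat.exists_eq_add_of_le' (show 4 ≤ i by omega)
        exact Or.inl ⟨x, by omega, by omega,
          fun h => by have := hinj x k (by omega) (by omega) hk hkn h; omega,
          (if_neg (by omega)).symm, insertRun_add_four_of_lt a (by omega)⟩
  rcases values i hi hin with ⟨x, x1, x2, x3, x4, x5⟩ | ⟨t, t1, t2, t3⟩ <;>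
    rcases values j hj hjn with ⟨y, y1, y2, y3, y4, y5⟩ | ⟨r, r1, r2, r3⟩
  · have hxy : a x = a y := by
      rw [x5, y5] at h
      split_ifs at h <;> omega
    rw [x4, y4, hinj x y x1 x2 y1 y2 hxy]
  · rw [x5, r3] at h
    split_ifs at h <;> omega
  · rw [t3, y5] at h
    split_ifs at h <;> omega
  · omega

theorem IsOpenMeandricPerm.insertRun {n k : ℕ} {a : ℕ → ℕ} (h : IsOpenMeandricPerm n a)
    (hk : 1 ≤ k) (hkn : k ≤ n) : IsOpenMeandricPerm (n + 4) (insertRun k a) := by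
  obtain ⟨hn, hrange, hinj, hpar, hup, hlow, hfirst, hlast⟩ := h
  have key : ∀ i, 1 ≤ i → i ≤ n + 4 → (1 ≤ _root_.insertRun k a i ∧
      _root_.insertRun k a i ≤ n + 4) ∧ _root_.insertRun k a i % 2 = i % 2 := by
    intro i hi hin
    have h1 := hrange i
    have h2 := hrange (i - 4)
    have h3 := hrange k hk hkn
    have h4 := hpar i
    have h5 := hpar (i - 4)
    have h6 := hpar k hk hkn
    unfold _root_.insertRun
    split_ifs <;> omega
  refine ⟨by omega, fun i hi hin => (key i hi hin).1,
    fun i j hi hin hj hjn => insertRun_injOn hk hkn hinj hi hin hj hjn,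
    fun i hi hin => (key i hi hin).2, ?_, ?_, ?_, ?_⟩
  · intro i j hi hin hj hjn
    rw [Nat.odd_iff] at hi hj
    refine insertRun_not_arcsCross hk hkn hinj 1 ?_ (by omega) hin hi (by omega) hjn hj
    intro i j _ hi hi' _ hj hj'
    exact hup i j (Nat.odd_iff.2 hi') hi (Nat.odd_iff.2 hj') hj
  · intro i j hi hi1 hin hj hj1 hjn
    rw [Nat.even_iff] at hi hj
    refine insertRun_not_arcsCross hk hkn hinj 0 ?_ hi1 hin hi hj1 hjn hj
    intro i j hi1 hi hi' hj1 hj hj'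
    exact hlow i j (Nat.even_iff.2 hi') hi1 hi (Nat.even_iff.2 hj') hj1 hj
  · intro i hi hi1 hin
    have h0 := insertRun_not_strictlyBetween hk hkn hinj 0 (a 1)
      (fun i h1 h2 h3 => hfirst i (Nat.even_iff.2 h3) h1 h2) hi1 hin (Nat.even_iff.1 hi)
    have e : openGap (if 0 % 2 = k % 2 then a k else a k + 1) (a 1) = _root_.insertRun k a 1 := by
      have h5 := hinj 1 k le_rfl hn hk hkn
      unfold openGap _root_.insertRun
      rcases eq_or_ne 1 k with rfl | h6
      · simp
      · grind
    rwa [e] at h0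
  · have hend : ∀ i, 1 ≤ i → i < n → i % 2 = n % 2 →
        ¬ StrictlyBetween (a i) (a (i + 1)) (a n) := by
      intro i h1 h2 h3
      split_ifs at hlast with hp
      · exact hlast i (Nat.even_iff.2 (h3.trans (Nat.even_iff.1 hp))) h1 h2
      · exact hlast i (Nat.odd_iff.2 (h3.trans (Nat.odd_iff.1 (Nat.not_even_iff_odd.1 hp)))) h2
    have e : openGap (if n % 2 = k % 2 then a k else a k + 1) (a n) =
        _root_.insertRun k a (n + 4) := by
      have h5 := hinj n k hn le_rfl hk hkn
      unfold openGap _root_.insertRun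
      rcases eq_or_ne n k with rfl | h6
      · simp
      · rw [if_neg (show ¬ n + 4 < k by omega), if_neg (show ¬ n + 4 ≤ k + 4 by omega),
          Nat.add_sub_cancel]
        grind
    have hend' : ∀ i, 1 ≤ i → i < n + 4 → i % 2 = n % 2 →
        ¬ StrictlyBetween (_root_.insertRun k a i) (_root_.insertRun k a (i + 1))
          (_root_.insertRun k a (n + 4)) := by
      intro i h1 h2 h3
      rw [← e]
      exact insertRun_not_strictlyBetween hk hkn hinj n (a n) hend h1 h2 h3
    split_ifs with hp
    · intro i hi h1 h2
      rw [Nat.even_iff] at hi hp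
      exact hend' i h1 h2 (by omega)
    · intro i hi h2
      rw [Nat.odd_iff] at hi
      rw [Nat.even_iff] at hp
      exact hend' i (by omega) h2 (by omega)

/-- The starting positions of the increasing runs of five consecutive values. -/
def runStarts (n : ℕ) (a : ℕ → ℕ) : Finset ℕ :=
  (Finset.Icc 1 n).filter fun i =>
    i + 4 ≤ n ∧ a (i + 1) = a i + 1 ∧ a (i + 2) = a (i + 1) + 1 ∧
      a (i + 3) = a (i + 2) + 1 ∧ a (i + 4) = a (i + 3) + 1

theorem mem_runStarts_insertRun {n k : ℕ} {a : ℕ → ℕ} (hk : 1 ≤ k) (hkn : k ≤ n) :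
    k ∈ runStarts (n + 4) (insertRun k a) := by
  simp only [runStarts, Finset.mem_filter, Finset.mem_Icc]
  unfold insertRun
  grind

theorem insertRun_succ_left {k i : ℕ} {a : ℕ → ℕ} (hi : i < k)
    (h : insertRun k a (i + 1) = insertRun k a i + 1) : a (i + 1) = a i + 1 := by
  unfold insertRun at h
  rcases eq_or_ne (i + 1) k with rfl | h2
  · grind
  · grind

theorem insertRun_succ_right {k i : ℕ} {a : ℕ → ℕ} (hi : k ≤ i)
    (h : insertRun k a (i + 4 + 1) = insertRun k a (i + 4) + 1) : a (i + 1) = a i + 1 := by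
  have e := insertRun_add_four_of_lt a (show k < i + 1 by omega)
  rw [show i + 1 + 4 = i + 4 + 1 by omega] at e
  rw [e] at h
  rcases eq_or_ne i k with rfl | h2
  · rw [insertRun_add i a le_rfl] at h
    split_ifs at h <;> omega
  · rw [insertRun_add_four_of_lt a (by omega)] at h
    split_ifs at h <;> omega

theorem card_runStarts_insertRun_le {n k : ℕ} {a : ℕ → ℕ} (hk : 1 ≤ k) (hkn : k ≤ n) :
    (runStarts (n + 4) (insertRun k a)).card ≤ (runStarts n a).card + 7 := by
  have hsub : runStarts (n + 4) (insertRun k a) ⊆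
      ((runStarts n a).filter (· + 4 ≤ k) ∪
        ((runStarts n a).filter (k ≤ ·)).image (· + 4)) ∪ Finset.Ico (k - 3) (k + 4) := by
    intro i hi
    simp only [runStarts, Finset.mem_filter, Finset.mem_Icc] at hi
    obtain ⟨⟨h1, -⟩, hn, r1, r2, r3, r4⟩ := hi
    simp only [runStarts, Finset.mem_union, Finset.mem_image, Finset.mem_filter,
      Finset.mem_Icc, Finset.mem_Ico]
    rcases le_or_gt (i + 4) k with h2 | h2
    · left; left
      exact ⟨⟨⟨h1, by omega⟩, by omega, insertRun_succ_left (by omega) r1,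
        insertRun_succ_left (by omega) r2, insertRun_succ_left (by omega) r3,
        insertRun_succ_left (by omega) r4⟩, h2⟩
    · rcases lt_or_ge i (k + 4) with h3 | h3
      · right
        omega
      · left; right
        obtain ⟨i, rfl⟩ := Nat.exists_eq_add_of_le' (show 4 ≤ i by omega)
        refine ⟨i, ⟨⟨⟨by omega, by omega⟩, by omega, ?_, ?_, ?_, ?_⟩, by omega⟩, rfl⟩
        · exact insertRun_succ_right (k := k) (by omega) r1
        · exact insertRun_succ_right (k := k) (i := i + 1) (by omega) r2
        · exact insertRun_succ_right (k := k) (i := i + 2) (by omega) r3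
        · exact insertRun_succ_right (k := k) (i := i + 3) (by omega) r4
  refine (Finset.card_le_card hsub).trans ((Finset.card_union_le _ _).trans ?_)
  refine Nat.add_le_add ((Finset.card_union_le _ _).trans ?_) (by rw [Nat.card_Ico]; omega)
  refine (Nat.add_le_add_left Finset.card_image_le _).trans ?_
  rw [← Finset.card_union_of_disjoint, ← Finset.filter_or]
  · exact Finset.card_le_card (Finset.filter_subset _ _)
  · rw [Finset.disjoint_filter]
    intro i _ h1 h2
    omega

theorem insertRun_left_injective {k : ℕ} {a b : ℕ → ℕ}
    (h : insertRun k a = insertRun k b) : a = b := by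
  have hk : a k = b k := by
    have := congrFun h k
    simpa [insertRun] using this
  funext i
  rcases lt_trichotomy i k with hi | rfl | hi
  · have := congrFun h i
    unfold insertRun at this
    grind
  · exact hk
  · have := congrFun h (i + 4)
    rw [insertRun_add_four_of_lt a hi, insertRun_add_four_of_lt b hi, hk] at this
    split_ifs at this <;> omega

/-- Normalized open meandric permutations of order `n`. -/
def openMeanders (n : ℕ) : Set (ℕ → ℕ) :=
  {a | IsOpenMeandricPerm n a ∧ ∀ i, i < 1 ∨ n < i → a i = 0}

theorem finite_openMeanders (n : ℕ) : (openMeanders n).Finite := by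
  refine Set.Finite.of_finite_image (f := fun a (i : Fin (n + 1)) => a i) ?_ ?_
  · refine (Set.finite_Iic (fun _ : Fin (n + 1) => n)).subset ?_
    rintro _ ⟨a, ⟨ha, h0⟩, rfl⟩ i
    rcases Nat.eq_zero_or_pos (i : ℕ) with hi | hi
    · simp [h0 i (by omega)]
    · exact (ha.2.1 i hi (by omega)).2
  · rintro a ⟨-, ha⟩ b ⟨-, hb⟩ hab
    funext i
    rcases lt_or_ge n i with hi | hi
    · rw [ha i (Or.inr hi), hb i (Or.inr hi)]
    · exact congrFun hab ⟨i, by omega⟩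

theorem insertRun_mem_openMeanders {n k : ℕ} {a : ℕ → ℕ} (h : a ∈ openMeanders n)
    (hk : 1 ≤ k) (hkn : k ≤ n) : insertRun k a ∈ openMeanders (n + 4) := by
  refine ⟨h.1.insertRun hk hkn, fun i hi => ?_⟩
  have h1 := h.2 i
  have h2 := h.2 (i - 4)
  unfold insertRun
  split_ifs <;> omega

/-- Open meanders with at most `m` increasing runs of five consecutive values. -/
noncomputable def fewRunMeanders (n m : ℕ) : Finset (ℕ → ℕ) :=
  (finite_openMeanders n).toFinset.filter fun a => (runStarts n a).card ≤ m

theorem mem_fewRunMeanders {n m : ℕ} {a : ℕ → ℕ} :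
    a ∈ fewRunMeanders n m ↔ a ∈ openMeanders n ∧ (runStarts n a).card ≤ m := by
  simp [fewRunMeanders]

theorem card_fewRunMeanders_le (n m : ℕ) :
    (fewRunMeanders n m).card ≤ openMeanderCount n := by
  have h : openMeanderCount n = (finite_openMeanders n).toFinset.card :=
    Set.ncard_eq_toFinset_card _ (finite_openMeanders n)
  rw [h]
  exact Finset.card_le_card (Finset.filter_subset _ _)

open scoped Classical in
theorem card_fewRunMeanders_mul_le (n m : ℕ) :
    (fewRunMeanders n m).card * n ≤ (m + 7) * (fewRunMeanders (n + 4) (m + 7)).card := by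
  have h := Finset.card_le_mul_card_image_of_maps_to
    (s := fewRunMeanders n m ×ˢ Finset.Icc 1 n) (t := fewRunMeanders (n + 4) (m + 7))
    (f := fun p => insertRun p.2 p.1) ?_ (m + 7) ?_
  · simpa using h
  · rintro ⟨a, k⟩ hp
    simp only [Finset.mem_product, Finset.mem_Icc, mem_fewRunMeanders] at hp ⊢
    exact ⟨insertRun_mem_openMeanders hp.1.1 hp.2.1 hp.2.2,
      (card_runStarts_insertRun_le hp.2.1 hp.2.2).trans (Nat.add_le_add_right hp.1.2 7)⟩
  · intro b hb
    refine le_trans ?_ (mem_fewRunMeanders.1 hb).2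
    refine Finset.card_le_card_of_injOn Prod.snd ?_ ?_
    · rintro ⟨a, k⟩ hp
      simp only [Finset.coe_filter, Finset.mem_product, Finset.mem_Icc, Set.mem_ofPred_eq] at hp
      obtain ⟨⟨-, h1, h2⟩, rfl⟩ := hp
      exact mem_runStarts_insertRun h1 h2
    · rintro ⟨a, k⟩ hp ⟨b, l⟩ hq hkl
      simp only [Finset.coe_filter, Set.mem_ofPred_eq] at hp hq hkl
      subst hkl
      rw [insertRun_left_injective (hp.2.trans hq.2.symm)]

theorem IsIrreducibleMeander.runStarts_eq_empty {n : ℕ} {a : ℕ → ℕ}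
    (h : IsIrreducibleMeander n a) (hn : 6 ≤ n) : runStarts n a = ∅ := by
  refine Finset.eq_empty_of_forall_notMem fun i hi => h ?_
  simp only [runStarts, Finset.mem_filter, Finset.mem_Icc] at hi
  obtain ⟨⟨h1, -⟩, h2, r1, r2, r3, r4⟩ := hi
  refine ⟨i, i + 4, by omega, h1, h2, by omega, by omega, ?_⟩
  have bounds : ∀ j ∈ Finset.Icc i (i + 4), a i ≤ a j ∧ a j ≤ a i + 4 := by
    intro j hj
    rw [Finset.mem_Icc] at hj
    obtain ⟨t, rfl⟩ := Nat.exists_eq_add_of_le hj.1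
    have ht : t ≤ 4 := by omega
    interval_cases t <;> (try rw [Nat.add_zero]) <;> omega
  have hsup : (Finset.Icc i (i + 4)).sup' (Finset.nonempty_Icc.mpr (by omega)) a = a i + 4 := by
    refine le_antisymm (Finset.sup'_le _ _ fun j hj => (bounds j hj).2) ?_
    exact le_trans (by omega) (Finset.le_sup' a (Finset.mem_Icc.2 ⟨by omega, le_refl (i + 4)⟩))
  have hinf : (Finset.Icc i (i + 4)).inf' (Finset.nonempty_Icc.mpr (by omega)) a = a i :=
    le_antisymm (Finset.inf'_le a (Finset.mem_Icc.2 ⟨le_refl i, by omega⟩))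
      (Finset.le_inf' _ _ fun j hj => (bounds j hj).1)
  rw [hsup, hinf]
  omega

theorem irrMeanderCount_le {n : ℕ} (hn : 6 ≤ n) :
    irrMeanderCount n ≤ (fewRunMeanders n 0).card := by
  rw [← Set.ncard_coe_finset]
  refine Set.ncard_le_ncard ?_ (Finset.finite_toSet _)
  rintro a ⟨h1, h2, h3⟩
  rw [Finset.mem_coe, mem_fewRunMeanders, h2.runStarts_eq_empty hn]
  exact ⟨⟨h1, h3⟩, by simp⟩

theorem irrMeanderCount_mul_pow_le {n : ℕ} (hn : 6 ≤ n) (j : ℕ) :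
    irrMeanderCount n * n ^ j ≤
      7 ^ j * j.factorial * (fewRunMeanders (n + 4 * j) (7 * j)).card := by
  induction j with
  | zero => simpa using irrMeanderCount_le hn
  | succ j ih =>
    have h := card_fewRunMeanders_mul_le (n + 4 * j) (7 * j)
    calc irrMeanderCount n * n ^ (j + 1) = irrMeanderCount n * n ^ j * n := by ring
      _ ≤ 7 ^ j * j.factorial * (fewRunMeanders (n + 4 * j) (7 * j)).card * (n + 4 * j) := by
        gcongr
        omega
      _ = 7 ^ j * j.factorial *
          ((fewRunMeanders (n + 4 * j) (7 * j)).card * (n + 4 * j)) := by ring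
      _ ≤ 7 ^ j * j.factorial *
          ((7 * j + 7) * (fewRunMeanders (n + 4 * j + 4) (7 * j + 7)).card) := by gcongr
      _ = 7 ^ (j + 1) * (j + 1).factorial *
          (fewRunMeanders (n + 4 * (j + 1)) (7 * (j + 1))).card := by
        rw [Nat.factorial_succ, mul_add 4 j 1, mul_add 7 j 1]
        simp only [mul_one, ← add_assoc]
        ring

theorem irrMeanderCount_mul_pow_le_openMeanderCount {n : ℕ} (hn : 6 ≤ n) {K j : ℕ}
    (hj : 1 ≤ j) (hjn : 7 * K * j ≤ n) :
    irrMeanderCount n * K ^ j ≤ openMeanderCount (n + 4 * j) := by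
  have h : 0 < 7 ^ j * j ^ j := by positivity
  refine Nat.le_of_mul_le_mul_left ?_ h
  calc 7 ^ j * j ^ j * (irrMeanderCount n * K ^ j)
      = irrMeanderCount n * (7 * K * j) ^ j := by rw [mul_pow, mul_pow]; ring
    _ ≤ irrMeanderCount n * n ^ j := by gcongr
    _ ≤ 7 ^ j * j.factorial * (fewRunMeanders (n + 4 * j) (7 * j)).card :=
        irrMeanderCount_mul_pow_le hn j
    _ ≤ 7 ^ j * j ^ j * openMeanderCount (n + 4 * j) := by
        gcongr
        · exact Nat.factorial_le_pow j
        · exact card_fewRunMeanders_le _ _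

/-- If `L = lim (M n)^(1/n)` exists and `3.37343 < L ≤ √12.901`,
then `M^{Irr} n / M n → 0`. -/
theorem irr_meander_proportion_tendsto_zero (L : ℝ)
    (hL : Tendsto (fun n : ℕ => (openMeanderCount n : ℝ) ^ (1 / (n : ℝ))) atTop (nhds L))
    (hL₁ : 3.37343 < L) (hL₂ : L ≤ Real.sqrt 12.901) :
    Tendsto (fun n : ℕ => (irrMeanderCount n : ℝ) / (openMeanderCount n : ℝ))
      atTop (nhds 0) := by
  have hL4 : L < 3.9 := hL₂.trans_lt ((Real.sqrt_lt' (by norm_num)).2 (by norm_num))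
  obtain ⟨u, v, hu, huL, hLv, hv4, huv⟩ : ∃ u v : ℝ, 0 < u ∧ u < L ∧ L < v ∧ v ≤ 4 ∧
      (v / u) ^ 14336 ≤ 2 := by
    have hc : Tendsto (fun η : ℝ => ((L + η) / (L - η)) ^ 14336) (nhds 0)
        (nhds (((L + 0) / (L - 0)) ^ 14336)) := by
      have : L - 0 ≠ 0 := by linarith
      exact ((tendsto_const_nhds.add tendsto_id).div (tendsto_const_nhds.sub tendsto_id)
        this).pow _
    rw [add_zero, sub_zero, div_self (by linarith), one_pow] at hc
    have h1 := hc.eventually (eventually_lt_nhds one_lt_two)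
    obtain ⟨δ, hδ, hball⟩ := Metric.eventually_nhds_iff.1 h1
    have hm : 0 < min (δ / 2) (1 / 10) := by positivity
    refine ⟨L - min (δ / 2) (1 / 10), L + min (δ / 2) (1 / 10), ?_, by linarith, by linarith,
      ?_, (hball ?_).le⟩
    · linarith [min_le_right (δ / 2) (1 / 10)]
    · linarith [min_le_right (δ / 2) (1 / 10)]
    · rw [Real.dist_eq, sub_zero, abs_of_pos hm]
      linarith [min_le_left (δ / 2) (1 / 10)]
  have hv : 0 < v := by linarith
  have hpow : ∀ n : ℕ, 1 ≤ n →
      ((openMeanderCount n : ℝ) ^ (1 / (n : ℝ))) ^ n = openMeanderCount n := fun n hn => by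
    rw [one_div]
    exact Real.rpow_inv_natCast_pow (Nat.cast_nonneg _) (by omega)
  obtain ⟨n₀, hn₀⟩ := eventually_atTop.1
    ((hL.eventually (eventually_gt_nhds huL)).and (hL.eventually (eventually_lt_nhds hLv)))
  have hlow : ∀ n, n₀ ≤ n → 1 ≤ n → u ^ n ≤ openMeanderCount n := fun n h h1 => by
    rw [← hpow n h1]
    exact pow_le_pow_left₀ hu.le (hn₀ n h).1.le n
  have hupp : ∀ n, n₀ ≤ n → 1 ≤ n → (openMeanderCount n : ℝ) ≤ v ^ n := fun n h h1 => by
    rw [← hpow n h1]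
    exact pow_le_pow_left₀ (by positivity) (hn₀ n h).2.le n
  have hdiv : Tendsto (fun n : ℕ => n / 7168) atTop atTop :=
    Nat.tendsto_div_const_atTop (by norm_num)
  have hlim : Tendsto (fun n : ℕ => (1 / 2 : ℝ) ^ (n / 7168)) atTop (nhds 0) :=
    (tendsto_pow_atTop_nhds_zero_of_lt_one (by norm_num) (by norm_num)).comp hdiv
  refine tendsto_of_tendsto_of_tendsto_of_le_of_le' tendsto_const_nhds hlim
    (Eventually.of_forall fun n => by positivity) ?_
  filter_upwards [eventually_ge_atTop n₀, eventually_ge_atTop 7168] with n hn hn'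
  set j := n / 7168 with hj
  have hj1 : 1 ≤ j := by omega
  have hmain : (irrMeanderCount n : ℝ) * 1024 ^ j ≤ openMeanderCount (n + 4 * j) := by
    exact_mod_cast irrMeanderCount_mul_pow_le_openMeanderCount (K := 1024)
      (by omega : 6 ≤ n) hj1 (by omega)
  have hM : 0 < (openMeanderCount n : ℝ) := (pow_pos hu n).trans_le (hlow n hn (by omega))
  have h2 : v ^ n ≤ 2 ^ j * u ^ n := by
    have h3 : (v / u) ^ n ≤ 2 ^ j := by
      calc (v / u) ^ n ≤ (v / u) ^ (14336 * j) :=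
            pow_le_pow_right₀ ((one_le_div hu).2 (by linarith)) (by omega)
        _ = ((v / u) ^ 14336) ^ j := pow_mul _ _ _
        _ ≤ 2 ^ j := pow_le_pow_left₀ (by positivity) huv j
    rwa [div_pow, div_le_iff₀ (pow_pos hu n)] at h3
  rw [div_le_iff₀ hM]
  refine le_of_mul_le_mul_right ?_ (show (0 : ℝ) < 1024 ^ j by positivity)
  calc (irrMeanderCount n : ℝ) * 1024 ^ j ≤ openMeanderCount (n + 4 * j) := hmain
    _ ≤ v ^ (n + 4 * j) := hupp _ (by omega) (by omega)
    _ = v ^ n * (v ^ 4) ^ j := by rw [pow_add, pow_mul]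
    _ ≤ 2 ^ j * u ^ n * 256 ^ j := by
        gcongr
        calc v ^ 4 ≤ 4 ^ 4 := by gcongr
          _ = 256 := by norm_num
    _ = (1 / 2) ^ j * u ^ n * 1024 ^ j := by
        rw [show (1024 : ℝ) = 2 * 2 * 256 by norm_num, mul_pow, mul_pow, one_div, inv_pow]
        field_simp
    _ ≤ (1 / 2) ^ j * openMeanderCount n * 1024 ^ j := by
        gcongr
        exact hlow n hn (by omega)
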